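/- Let k,s ≥ 1 both be odd. Then dim_F T₁(A^{k,s}_0) = dim_F T₁(A^{k,s}_1) + 1; in particular the spaces T₁(A^{k,s}_0) and T₁(A^{k,s}_1) have different F-dimensions. -/

import Mathlib

/- Common setup: the algebras D(2B)^{k,s}(c) of dihedral type, over a field F,
   presented as a quotient of the free algebra on the paths-generators
   e₁, e₂ (trivial paths), α (loop at vertex 1), β (arrow 1 → 2),
   γ (arrow 2 → 1), η (loop at vertex 2), by the path-algebra relations
   together with Erdmann's relations
   βη = 0, ηγ = 0, γβ = 0, α² = c(αβγ)^k, (αβγ)^k = (βγα)^k, η^s = (γαβ)^k. -/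

noncomputable section

namespace DihedralPaper

inductive Gen : Type
  | e1 | e2 | a | b | g | h

variable (F : Type) [Field F]

/-- The generators inside the free algebra. -/
def gen (t : Gen) : FreeAlgebra F Gen := FreeAlgebra.ι F t

/-- The defining relations of `D(2B)^{k,s}(c)` (paths written from left to right). -/
inductive Rel (k s : ℕ) (c : F) : FreeAlgebra F Gen → FreeAlgebra F Gen → Prop
  | unit : Rel k s c (gen F .e1 + gen F .e2) 1
  | idem1 : Rel k s c (gen F .e1 * gen F .e1) (gen F .e1)
  | idem2 : Rel k s c (gen F .e2 * gen F .e2) (gen F .e2)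
  | orth12 : Rel k s c (gen F .e1 * gen F .e2) 0
  | orth21 : Rel k s c (gen F .e2 * gen F .e1) 0
  | aL : Rel k s c (gen F .e1 * gen F .a) (gen F .a)
  | aR : Rel k s c (gen F .a * gen F .e1) (gen F .a)
  | bL : Rel k s c (gen F .e1 * gen F .b) (gen F .b)
  | bR : Rel k s c (gen F .b * gen F .e2) (gen F .b)
  | gL : Rel k s c (gen F .e2 * gen F .g) (gen F .g)
  | gR : Rel k s c (gen F .g * gen F .e1) (gen F .g)
  | hL : Rel k s c (gen F .e2 * gen F .h) (gen F .h)
  | hR : Rel k s c (gen F .h * gen F .e2) (gen F .h)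
  | bh : Rel k s c (gen F .b * gen F .h) 0
  | hg : Rel k s c (gen F .h * gen F .g) 0
  | gb : Rel k s c (gen F .g * gen F .b) 0
  | asq : Rel k s c (gen F .a * gen F .a) (c • (gen F .a * gen F .b * gen F .g) ^ k)
  | abg : Rel k s c ((gen F .a * gen F .b * gen F .g) ^ k) ((gen F .b * gen F .g * gen F .a) ^ k)
  | hs : Rel k s c ((gen F .h) ^ s) ((gen F .g * gen F .a * gen F .b) ^ k)

/-- The algebra `A^{k,s}_c = D(2B)^{k,s}(c)`. -/
def DA (k s : ℕ) (c : F) : Type := RingQuot (Rel F k s c)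

instance (k s : ℕ) (c : F) : Ring (DA F k s c) :=
  inferInstanceAs (Ring (RingQuot (Rel F k s c)))

instance (k s : ℕ) (c : F) : Algebra F (DA F k s c) :=
  inferInstanceAs (Algebra F (RingQuot (Rel F k s c)))

variable (k s : ℕ) (c : F)

/-- The canonical projection. -/
def mk : FreeAlgebra F Gen →ₐ[F] DA F k s c := RingQuot.mkAlgHom F (Rel F k s c)

def E1 : DA F k s c := mk F k s c (gen F .e1)
def E2 : DA F k s c := mk F k s c (gen F .e2)
/-- The image of the loop α at vertex 1. -/
def Al : DA F k s c := mk F k s c (gen F .a)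
/-- The image of the arrow β : 1 → 2. -/
def Be : DA F k s c := mk F k s c (gen F .b)
/-- The image of the arrow γ : 2 → 1. -/
def Ga : DA F k s c := mk F k s c (gen F .g)
/-- The image of the loop η at vertex 2. -/
def Et : DA F k s c := mk F k s c (gen F .h)

/-- The path αβγ. -/
def ABG : DA F k s c := Al F k s c * Be F k s c * Ga F k s c
/-- The path βγα. -/
def BGA : DA F k s c := Be F k s c * Ga F k s c * Al F k s c
/-- The path γαβ. -/
def GAB : DA F k s c := Ga F k s c * Al F k s c * Be F k s c

/-- The standard basis paths 𝓑₁₁ of e₁Ae₁. -/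
def B11 : Set (DA F k s c) :=
  {E1 F k s c, Al F k s c, Be F k s c * Ga F k s c, (ABG F k s c) ^ k}
    ∪ (fun i => (ABG F k s c) ^ i) '' Set.Icc 1 (k - 1)
    ∪ (fun i => (ABG F k s c) ^ i * Al F k s c) '' Set.Icc 1 (k - 1)
    ∪ (fun i => (BGA F k s c) ^ i) '' Set.Icc 1 (k - 1)
    ∪ (fun i => (BGA F k s c) ^ i * (Be F k s c * Ga F k s c)) '' Set.Icc 1 (k - 1)

/-- The standard basis paths 𝓑₁₂ of e₁Ae₂. -/
def B12 : Set (DA F k s c) :=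
  {Be F k s c, Al F k s c * Be F k s c}
    ∪ (fun i => (BGA F k s c) ^ i * Be F k s c) '' Set.Icc 1 (k - 1)
    ∪ (fun i => (ABG F k s c) ^ i * (Al F k s c * Be F k s c)) '' Set.Icc 1 (k - 1)

/-- The standard basis paths 𝓑₂₁ of e₂Ae₁. -/
def B21 : Set (DA F k s c) :=
  {Ga F k s c, Ga F k s c * Al F k s c}
    ∪ (fun i => (GAB F k s c) ^ i * Ga F k s c) '' Set.Icc 1 (k - 1)
    ∪ (fun i => (GAB F k s c) ^ i * (Ga F k s c * Al F k s c)) '' Set.Icc 1 (k - 1)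

/-- The standard basis paths 𝓑₂₂ of e₂Ae₂. -/
def B22 : Set (DA F k s c) :=
  {E2 F k s c}
    ∪ (fun i => (GAB F k s c) ^ i) '' Set.Icc 1 (k - 1)
    ∪ (fun j => (Et F k s c) ^ j) '' Set.Icc 1 s

/-- The standard path basis 𝓑 of `A^{k,s}_c`. -/
def BB : Set (DA F k s c) :=
  B11 F k s c ∪ B12 F k s c ∪ B21 F k s c ∪ B22 F k s c

/-- The commutator subspace K(A): the F-linear span of all commutators. -/
def Kspan (A : Type) [Ring A] [Algebra F A] : Submodule F A :=
  Submodule.span F {z : A | ∃ u v : A, z = u * v - v * u}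

/-- The (left) socle of a ring: the sum of all simple (left) submodules. -/
def socle (A : Type) [Ring A] : Submodule A A := sSup {S : Submodule A A | IsAtom S}

/-- `ψ` is the linear form sending each standard basis path lying in the socle to 1
    and every other standard basis path to 0. -/
def SoclePsi (ψ : DA F k s c →ₗ[F] F) : Prop :=
  ∀ p ∈ BB F k s c,
    (p ∈ socle (DA F k s c) → ψ p = 1) ∧ (p ∉ socle (DA F k s c) → ψ p = 0)

/-- `T₁(A) = {x : x² ∈ K(A)}`. -/
def T1set : Set (DA F k s c) := {z | z ^ 2 ∈ Kspan F (DA F k s c)}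

/-- The orthogonal space `T₁(A)^⊥` with respect to the form `⟨x, y⟩ = ψ(xy)`. -/
def T1perp (ψ : DA F k s c →ₗ[F] F) : Set (DA F k s c) :=
  {y | ∀ x ∈ T1set F k s c, ψ (y * x) = 0}

/-- The first generalized Reynolds ideal, as an ideal of the center `Z(A)`. -/
def ReynoldsIdeal (ψ : DA F k s c →ₗ[F] F) :
    Ideal (Subalgebra.center F (DA F k s c)) :=
  Ideal.span {z : Subalgebra.center F (DA F k s c) | (z : DA F k s c) ∈ T1perp F k s c ψ}

section Basic

variable {F} {k s} {c}

/-- The universal property of `DA F k s c`. -/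
def liftDA {B : Type} [Ring B] [Algebra F B] (f : FreeAlgebra F Gen →ₐ[F] B)
    (hf : ∀ ⦃x y⦄, Rel F k s c x y → f x = f y) : DA F k s c →ₐ[F] B :=
  RingQuot.liftAlgHom F ⟨f, hf⟩

theorem liftDA_mk {B : Type} [Ring B] [Algebra F B] (f : FreeAlgebra F Gen →ₐ[F] B)
    (hf : ∀ ⦃x y⦄, Rel F k s c x y → f x = f y) (x : FreeAlgebra F Gen) :
    liftDA f hf (mk F k s c x) = f x :=
  RingQuot.liftAlgHom_mkAlgHom_apply F f hf x

theorem mk_surjective : Function.Surjective (mk F k s c) :=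
  RingQuot.mkAlgHom_surjective F (Rel F k s c)

theorem mk_rel {x y : FreeAlgebra F Gen} (h : Rel F k s c x y) :
    mk F k s c x = mk F k s c y :=
  RingQuot.mkAlgHom_rel F h

theorem DA_induction {motive : DA F k s c → Prop}
    (scalar : ∀ r, motive (algebraMap F _ r)) (generator : ∀ t, motive (mk F k s c (gen F t)))
    (mul : ∀ x y, motive x → motive y → motive (x * y))
    (add : ∀ x y, motive x → motive y → motive (x + y)) (x : DA F k s c) : motive x := by
  obtain ⟨x, rfl⟩ := mk_surjective x
  induction x using FreeAlgebra.induction with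
  | grade0 r => simpa using scalar r
  | grade1 t => exact generator t
  | mul a b ha hb => simpa using mul _ _ ha hb
  | add a b ha hb => simpa using add _ _ ha hb

/-- A subspace containing `1` and stable under left multiplication by the generators is
everything. -/
theorem mem_of_generator_mul_mem {V : Submodule F (DA F k s c)} (h1 : 1 ∈ V)
    (hV : ∀ t, ∀ v ∈ V, mk F k s c (gen F t) * v ∈ V) (x : DA F k s c) : x ∈ V := by
  have key : ∀ x : DA F k s c, ∀ v ∈ V, x * v ∈ V := by
    intro x
    induction x using DA_induction with
    | scalar r => intro v hv; rw [← Algebra.smul_def]; exact V.smul_mem r hv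
    | generator t => exact hV t
    | mul x y hx hy => intro v hv; rw [mul_assoc]; exact hx _ (hy _ hv)
    | add x y hx hy => intro v hv; rw [add_mul]; exact V.add_mem (hx _ hv) (hy _ hv)
  simpa using key x 1 h1

theorem E1_add_E2 : E1 F k s c + E2 F k s c = 1 := by
  simpa [E1, E2] using mk_rel (Rel.unit (F := F) (k := k) (s := s) (c := c))
theorem E1_mul_E1 : E1 F k s c * E1 F k s c = E1 F k s c := by
  simpa [E1] using mk_rel (Rel.idem1 (F := F) (k := k) (s := s) (c := c))
theorem E2_mul_E2 : E2 F k s c * E2 F k s c = E2 F k s c := by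
  simpa [E2] using mk_rel (Rel.idem2 (F := F) (k := k) (s := s) (c := c))
theorem E1_mul_E2 : E1 F k s c * E2 F k s c = 0 := by
  simpa [E1, E2] using mk_rel (Rel.orth12 (F := F) (k := k) (s := s) (c := c))
theorem E2_mul_E1 : E2 F k s c * E1 F k s c = 0 := by
  simpa [E1, E2] using mk_rel (Rel.orth21 (F := F) (k := k) (s := s) (c := c))
theorem E1_mul_Al : E1 F k s c * Al F k s c = Al F k s c := by
  simpa [E1, Al] using mk_rel (Rel.aL (F := F) (k := k) (s := s) (c := c))
theorem Al_mul_E1 : Al F k s c * E1 F k s c = Al F k s c := by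
  simpa [E1, Al] using mk_rel (Rel.aR (F := F) (k := k) (s := s) (c := c))
theorem E1_mul_Be : E1 F k s c * Be F k s c = Be F k s c := by
  simpa [E1, Be] using mk_rel (Rel.bL (F := F) (k := k) (s := s) (c := c))
theorem Be_mul_E2 : Be F k s c * E2 F k s c = Be F k s c := by
  simpa [E2, Be] using mk_rel (Rel.bR (F := F) (k := k) (s := s) (c := c))
theorem E2_mul_Ga : E2 F k s c * Ga F k s c = Ga F k s c := by
  simpa [E2, Ga] using mk_rel (Rel.gL (F := F) (k := k) (s := s) (c := c))
theorem Ga_mul_E1 : Ga F k s c * E1 F k s c = Ga F k s c := by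
  simpa [E1, Ga] using mk_rel (Rel.gR (F := F) (k := k) (s := s) (c := c))
theorem E2_mul_Et : E2 F k s c * Et F k s c = Et F k s c := by
  simpa [E2, Et] using mk_rel (Rel.hL (F := F) (k := k) (s := s) (c := c))
theorem Et_mul_E2 : Et F k s c * E2 F k s c = Et F k s c := by
  simpa [E2, Et] using mk_rel (Rel.hR (F := F) (k := k) (s := s) (c := c))
theorem Be_mul_Et : Be F k s c * Et F k s c = 0 := by
  simpa [Be, Et] using mk_rel (Rel.bh (F := F) (k := k) (s := s) (c := c))
theorem Et_mul_Ga : Et F k s c * Ga F k s c = 0 := by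
  simpa [Ga, Et] using mk_rel (Rel.hg (F := F) (k := k) (s := s) (c := c))
theorem Ga_mul_Be : Ga F k s c * Be F k s c = 0 := by
  simpa [Ga, Be] using mk_rel (Rel.gb (F := F) (k := k) (s := s) (c := c))
theorem Al_mul_Al : Al F k s c * Al F k s c = c • ABG F k s c ^ k := by
  simpa [Al, Be, Ga, ABG] using mk_rel (Rel.asq (F := F) (k := k) (s := s) (c := c))
theorem BGA_pow : BGA F k s c ^ k = ABG F k s c ^ k := by
  simpa [Al, Be, Ga, ABG, BGA] using (mk_rel (Rel.abg (F := F) (k := k) (s := s) (c := c))).symm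
theorem Et_pow : Et F k s c ^ s = GAB F k s c ^ k := by
  simpa [Al, Be, Ga, Et, GAB] using mk_rel (Rel.hs (F := F) (k := k) (s := s) (c := c))

theorem Be_mul_E1 : Be F k s c * E1 F k s c = 0 := by
  rw [← Be_mul_E2, mul_assoc, E2_mul_E1, mul_zero]
theorem E1_mul_Ga : E1 F k s c * Ga F k s c = 0 := by
  rw [← E2_mul_Ga, ← mul_assoc, E1_mul_E2, zero_mul]
theorem E1_mul_Et : E1 F k s c * Et F k s c = 0 := by
  rw [← E2_mul_Et, ← mul_assoc, E1_mul_E2, zero_mul]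
theorem Et_mul_E1 : Et F k s c * E1 F k s c = 0 := by
  rw [← Et_mul_E2, mul_assoc, E2_mul_E1, mul_zero]

theorem Al_mul_BGA_pow (n : ℕ) :
    Al F k s c * BGA F k s c ^ n = ABG F k s c ^ n * Al F k s c := by
  have h : SemiconjBy (Al F k s c) (BGA F k s c) (ABG F k s c) := by
    simp only [SemiconjBy, ABG, BGA, mul_assoc]
  exact h.pow_right n

theorem Ga_mul_ABG_pow (n : ℕ) :
    Ga F k s c * ABG F k s c ^ n = GAB F k s c ^ n * Ga F k s c := by
  have h : SemiconjBy (Ga F k s c) (ABG F k s c) (GAB F k s c) := by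
    simp only [SemiconjBy, ABG, GAB, mul_assoc]
  exact h.pow_right n

/-- The socle element `(αβγ)^k`. -/
def Soc (F : Type) [Field F] (k s : ℕ) (c : F) : DA F k s c := ABG F k s c ^ k

theorem E1_mul_Soc (hk : 1 ≤ k) : E1 F k s c * Soc F k s c = Soc F k s c := by
  obtain ⟨k, rfl⟩ := Nat.exists_eq_add_of_le' hk
  simp only [Soc, pow_succ', ABG, ← mul_assoc, E1_mul_Al]

theorem Soc_mul_E1 (hk : 1 ≤ k) : Soc F k s c * E1 F k s c = Soc F k s c := by
  obtain ⟨k, rfl⟩ := Nat.exists_eq_add_of_le' hk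
  simp only [Soc, pow_succ, ABG, mul_assoc, Ga_mul_E1]

theorem E2_mul_Soc (hk : 1 ≤ k) : E2 F k s c * Soc F k s c = 0 := by
  rw [← E1_mul_Soc hk, ← mul_assoc, E2_mul_E1, zero_mul]
theorem Soc_mul_E2 (hk : 1 ≤ k) : Soc F k s c * E2 F k s c = 0 := by
  rw [← Soc_mul_E1 hk, mul_assoc, E1_mul_E2, mul_zero]
theorem Be_mul_Soc (hk : 1 ≤ k) : Be F k s c * Soc F k s c = 0 := by
  rw [← E1_mul_Soc hk, ← mul_assoc, Be_mul_E1, zero_mul]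
theorem Et_mul_Soc (hk : 1 ≤ k) : Et F k s c * Soc F k s c = 0 := by
  rw [← E1_mul_Soc hk, ← mul_assoc, Et_mul_E1, zero_mul]
theorem Soc_mul_Ga (hk : 1 ≤ k) : Soc F k s c * Ga F k s c = 0 := by
  rw [← Soc_mul_E1 hk, mul_assoc, E1_mul_Ga, mul_zero]
theorem Soc_mul_Et (hk : 1 ≤ k) : Soc F k s c * Et F k s c = 0 := by
  rw [← Soc_mul_E1 hk, mul_assoc, E1_mul_Et, mul_zero]

theorem Ga_mul_Soc (hk : 1 ≤ k) : Ga F k s c * Soc F k s c = 0 := by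
  rw [Soc, ← BGA_pow]
  obtain ⟨k, rfl⟩ := Nat.exists_eq_add_of_le' hk
  simp only [pow_succ', BGA, ← mul_assoc, Ga_mul_Be, zero_mul]

theorem Soc_mul_Be (hk : 1 ≤ k) : Soc F k s c * Be F k s c = 0 := by
  rw [Soc]
  obtain ⟨k, rfl⟩ := Nat.exists_eq_add_of_le' hk
  simp only [pow_succ, ABG, mul_assoc, Ga_mul_Be, mul_zero]

theorem Soc_mul_Al (hk : 1 ≤ k) : Soc F k s c * Al F k s c = 0 := by
  have h : BGA F k s c ^ k * Al F k s c = 0 := by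
    obtain ⟨j, hj⟩ := Nat.exists_eq_add_of_le' hk
    have h1 : BGA F k s c ^ k = BGA F k s c ^ j * Be F k s c * Ga F k s c * Al F k s c := by
      rw [hj, pow_succ, BGA]; simp only [mul_assoc]
    rw [h1, mul_assoc, Al_mul_Al, mul_smul_comm, mul_assoc]
    change c • (_ * (_ * Soc F k s c)) = 0
    rw [Ga_mul_Soc hk, mul_zero, smul_zero]
  rwa [BGA_pow] at h

theorem Al_mul_Soc (hk : 1 ≤ k) : Al F k s c * Soc F k s c = 0 := by
  rw [Soc, ← BGA_pow, Al_mul_BGA_pow]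
  exact Soc_mul_Al hk

end Basic

section Dual

variable {F} {k s} {c}

/-- The values of the generators under the algebra map to the dual numbers that records the
coefficients of `e₁` and `α`. -/
def dualGen (F : Type) [Field F] : Gen → DualNumber F
  | .e1 => 1
  | .a => DualNumber.eps
  | _ => 0

theorem dualGen_rel (hk : 1 ≤ k) (hs : 1 ≤ s) ⦃x y : FreeAlgebra F Gen⦄ (h : Rel F k s c x y) :
    FreeAlgebra.lift F (dualGen F) x = FreeAlgebra.lift F (dualGen F) y := by
  have hk' : k ≠ 0 := by omega
  have hs' : s ≠ 0 := by omega
  cases h <;> simp [gen, dualGen, hk', hs']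

/-- The algebra map to the dual numbers recording the coefficients of `e₁` and `α`. -/
def dual (c : F) (hk : 1 ≤ k) (hs : 1 ≤ s) : DA F k s c →ₐ[F] DualNumber F :=
  liftDA (FreeAlgebra.lift F (dualGen F)) (dualGen_rel hk hs)

theorem dual_gen (hk : 1 ≤ k) (hs : 1 ≤ s) (t : Gen) :
    dual c hk hs (mk F k s c (gen F t)) = dualGen F t := by
  simp [dual, liftDA_mk, gen]

/-- The coefficient of `e₁`. -/
def coeffE1 (c : F) (hk : 1 ≤ k) (hs : 1 ≤ s) : DA F k s c →ₗ[F] F :=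
  (TrivSqZeroExt.fstHom F F F).toLinearMap ∘ₗ (dual c hk hs).toLinearMap

/-- The coefficient of `α`. -/
def coeffAl (c : F) (hk : 1 ≤ k) (hs : 1 ≤ s) : DA F k s c →ₗ[F] F :=
  TrivSqZeroExt.sndHom F F ∘ₗ (dual c hk hs).toLinearMap

variable (hk : 1 ≤ k) (hs : 1 ≤ s)

theorem coeffE1_mul (x y : DA F k s c) :
    coeffE1 c hk hs (x * y) = coeffE1 c hk hs x * coeffE1 c hk hs y := by
  simp [coeffE1]

theorem coeffAl_mul (x y : DA F k s c) :
    coeffAl c hk hs (x * y) =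
      coeffE1 c hk hs x * coeffAl c hk hs y + coeffAl c hk hs x * coeffE1 c hk hs y := by
  simp [coeffE1, coeffAl, mul_comm]

theorem coeffE1_algebraMap (r : F) : coeffE1 c hk hs (algebraMap F _ r) = r := by
  simp [coeffE1, TrivSqZeroExt.algebraMap_eq_inl]

theorem coeffAl_algebraMap (r : F) : coeffAl c hk hs (algebraMap F _ r) = 0 := by
  simp [coeffAl, TrivSqZeroExt.algebraMap_eq_inl]

theorem coeffE1_gen (t : Gen) :
    coeffE1 c hk hs (mk F k s c (gen F t)) = (dualGen F t).fst := by
  simp [coeffE1, dual_gen]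

theorem coeffAl_gen (t : Gen) :
    coeffAl c hk hs (mk F k s c (gen F t)) = (dualGen F t).snd := by
  simp [coeffAl, dual_gen]

theorem coeffE1_Al : coeffE1 c hk hs (Al F k s c) = 0 := by
  simp [Al, coeffE1_gen, dualGen]
theorem coeffE1_Be : coeffE1 c hk hs (Be F k s c) = 0 := by
  simp [Be, coeffE1_gen, dualGen]
theorem coeffE1_Ga : coeffE1 c hk hs (Ga F k s c) = 0 := by
  simp [Ga, coeffE1_gen, dualGen]
theorem coeffE1_E1 : coeffE1 c hk hs (E1 F k s c) = 1 := by
  simp [E1, coeffE1_gen, dualGen]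
theorem coeffAl_Al : coeffAl c hk hs (Al F k s c) = 1 := by
  simp [Al, coeffAl_gen, dualGen]
theorem coeffAl_Be : coeffAl c hk hs (Be F k s c) = 0 := by
  simp [Be, coeffAl_gen, dualGen]
theorem coeffAl_Ga : coeffAl c hk hs (Ga F k s c) = 0 := by
  simp [Ga, coeffAl_gen, dualGen]
theorem coeffAl_E1 : coeffAl c hk hs (E1 F k s c) = 0 := by
  simp [E1, coeffAl_gen, dualGen]

theorem coeffE1_Soc : coeffE1 c hk hs (Soc F k s c) = 0 := by
  obtain ⟨k, rfl⟩ := Nat.exists_eq_add_of_le' hk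
  simp [Soc, ABG, pow_succ, coeffE1_mul, coeffE1_Be]

theorem coeffAl_Soc : coeffAl c hk hs (Soc F k s c) = 0 := by
  obtain ⟨k, rfl⟩ := Nat.exists_eq_add_of_le' hk
  simp [Soc, ABG, pow_succ, coeffE1_mul, coeffE1_Be, coeffE1_Ga, coeffAl_mul, coeffAl_Ga]

theorem mul_Soc (x : DA F k s c) : x * Soc F k s c = coeffE1 c hk hs x • Soc F k s c := by
  induction x using DA_induction with
  | scalar r => rw [coeffE1_algebraMap, Algebra.smul_def]
  | generator t =>
    rw [coeffE1_gen]
    cases t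
    · simpa [dualGen, E1] using E1_mul_Soc hk
    · simpa [dualGen, E2] using E2_mul_Soc hk
    · simpa [dualGen, Al] using Al_mul_Soc hk
    · simpa [dualGen, Be] using Be_mul_Soc hk
    · simpa [dualGen, Ga] using Ga_mul_Soc hk
    · simpa [dualGen, Et] using Et_mul_Soc hk
  | mul x y hx hy =>
    rw [mul_assoc, hy, mul_smul_comm, hx, coeffE1_mul, smul_smul, mul_comm]
  | add x y hx hy => rw [add_mul, hx, hy, map_add, add_smul]

theorem Soc_mul (x : DA F k s c) : Soc F k s c * x = coeffE1 c hk hs x • Soc F k s c := by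
  induction x using DA_induction with
  | scalar r => rw [coeffE1_algebraMap, ← Algebra.commutes, Algebra.smul_def]
  | generator t =>
    rw [coeffE1_gen]
    cases t
    · simpa [dualGen, E1] using Soc_mul_E1 hk
    · simpa [dualGen, E2] using Soc_mul_E2 hk
    · simpa [dualGen, Al] using Soc_mul_Al hk
    · simpa [dualGen, Be] using Soc_mul_Be hk
    · simpa [dualGen, Ga] using Soc_mul_Ga hk
    · simpa [dualGen, Et] using Soc_mul_Et hk
  | mul x y hx hy =>
    rw [← mul_assoc, hx, smul_mul_assoc, hy, coeffE1_mul, smul_smul]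
  | add x y hx hy => rw [mul_add, hx, hy, map_add, add_smul]

/-- The perturbation by which left multiplication by `α` is twisted. -/
def perturb (c : F) : Module.End F (DA F k s c) := (coeffAl c hk hs).smulRight (Soc F k s c)

theorem perturb_apply (y : DA F k s c) :
    perturb hk hs c y = coeffAl c hk hs y • Soc F k s c := rfl

theorem mulLeft_mul_perturb (x : DA F k s c) :
    LinearMap.mulLeft F x * perturb hk hs c = coeffE1 c hk hs x • perturb hk hs c := by
  ext y
  simp only [Module.End.mul_apply, LinearMap.mulLeft_apply, LinearMap.smul_apply, perturb_apply,
    mul_smul_comm, mul_Soc hk hs]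
  exact smul_comm _ _ _

theorem perturb_mul_mulLeft (x : DA F k s c) :
    perturb hk hs c * LinearMap.mulLeft F x =
      coeffE1 c hk hs x • perturb hk hs c +
        coeffAl c hk hs x • LinearMap.mulLeft F (Soc F k s c) := by
  ext y
  simp only [Module.End.mul_apply, LinearMap.mulLeft_apply, LinearMap.smul_apply, perturb_apply,
    LinearMap.add_apply, Soc_mul hk hs, coeffAl_mul, add_smul, smul_smul]

theorem perturb_mul_perturb : perturb hk hs c * perturb hk hs c = 0 := by
  ext y
  simp [Module.End.mul_apply, perturb_apply, coeffAl_Soc]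

/-- The operators on `DA F k s c` by which the generators of `DA F k s c'` act: left
multiplications, with that by `α` corrected by a multiple of `perturb`. -/
def twistGen (c c' : F) : Gen → Module.End F (DA F k s c)
  | .e1 => LinearMap.mulLeft F (E1 F k s c)
  | .e2 => LinearMap.mulLeft F (E2 F k s c)
  | .a => LinearMap.mulLeft F (Al F k s c) + (c' - c) • perturb hk hs c
  | .b => LinearMap.mulLeft F (Be F k s c)
  | .g => LinearMap.mulLeft F (Ga F k s c)
  | .h => LinearMap.mulLeft F (Et F k s c)

theorem twistGen_apply (c c' : F) (t : Gen) (y : DA F k s c) :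
    twistGen hk hs c c' t y = mk F k s c (gen F t) * y +
      ((c' - c) * coeffAl c hk hs (mk F k s c (gen F t)) * coeffAl c hk hs y) • Soc F k s c := by
  rw [coeffAl_gen]
  cases t <;> simp [twistGen, dualGen, E1, E2, Al, Be, Ga, Et, perturb_apply, smul_smul]

theorem mulLeft_mul_mulLeft (x y : DA F k s c) :
    LinearMap.mulLeft F x * LinearMap.mulLeft F y = LinearMap.mulLeft F (x * y) := by
  ext z
  simp

theorem twistGen_rel (c c' : F) ⦃x y : FreeAlgebra F Gen⦄ (h : Rel F k s c' x y) :
    FreeAlgebra.lift F (twistGen hk hs c c') x = FreeAlgebra.lift F (twistGen hk hs c c') y := by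
  have habg : twistGen hk hs c c' .a * twistGen hk hs c c' .b * twistGen hk hs c c' .g =
      LinearMap.mulLeft F (ABG F k s c) := by
    simp [-LinearMap.mulLeft_mul, twistGen, add_mul, mulLeft_mul_mulLeft, perturb_mul_mulLeft, ABG,
      coeffE1_Be, coeffAl_Be]
  have hbga : twistGen hk hs c c' .b * twistGen hk hs c c' .g * twistGen hk hs c c' .a =
      LinearMap.mulLeft F (BGA F k s c) := by
    simp [-LinearMap.mulLeft_mul, twistGen, mul_add, mulLeft_mul_mulLeft, mulLeft_mul_perturb, BGA,
      coeffE1_mul, coeffE1_Be]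
  have hgab : twistGen hk hs c c' .g * twistGen hk hs c c' .a * twistGen hk hs c c' .b =
      LinearMap.mulLeft F (GAB F k s c) := by
    simp [-LinearMap.mulLeft_mul, twistGen, mul_add, mulLeft_mul_mulLeft, mulLeft_mul_perturb, GAB,
      coeffE1_Ga]
  have haa : twistGen hk hs c c' .a * twistGen hk hs c c' .a =
      c' • LinearMap.mulLeft F (Soc F k s c) := by
    have hS : LinearMap.mulLeft F (Al F k s c * Al F k s c) =
        c • LinearMap.mulLeft F (Soc F k s c) := by
      ext y
      simp [Al_mul_Al, Soc]
    simp only [twistGen, mul_add, add_mul, mulLeft_mul_mulLeft, mulLeft_mul_perturb,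
      perturb_mul_mulLeft, perturb_mul_perturb, smul_mul_assoc, mul_smul_comm, coeffE1_Al,
      coeffAl_Al, hS, zero_smul, smul_zero, one_smul, add_zero, zero_add, ← add_smul]
    congr 1
    ring
  cases h
  case asq =>
    simp only [map_mul, map_smul, map_pow, gen, FreeAlgebra.lift_ι_apply, habg, haa,
      LinearMap.pow_mulLeft, Soc]
  case abg =>
    simp only [map_mul, map_pow, gen, FreeAlgebra.lift_ι_apply, habg, hbga, LinearMap.pow_mulLeft,
      BGA_pow]
  case hs =>
    simp only [map_mul, map_pow, gen, FreeAlgebra.lift_ι_apply, hgab]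
    simp only [twistGen, LinearMap.pow_mulLeft, Et_pow]
  case unit =>
    simp only [map_add, map_one, gen, FreeAlgebra.lift_ι_apply, twistGen]
    ext y
    simp [← add_mul, E1_add_E2]
  all_goals
    simp [gen, twistGen, mul_add, add_mul, mulLeft_mul_mulLeft, mulLeft_mul_perturb,
      perturb_mul_mulLeft, E1_mul_E1, E2_mul_E2, E1_mul_E2, E2_mul_E1, E1_mul_Al, Al_mul_E1,
      E1_mul_Be, Be_mul_E2, E2_mul_Ga, Ga_mul_E1, E2_mul_Et, Et_mul_E2, Be_mul_Et, Et_mul_Ga,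
      Ga_mul_Be, coeffE1_E1, coeffAl_E1]

/-- The action of `DA F k s c'` on `DA F k s c` by twisted left multiplications. -/
def twist (c c' : F) : DA F k s c' →ₐ[F] Module.End F (DA F k s c) :=
  liftDA (FreeAlgebra.lift F (twistGen hk hs c c')) (twistGen_rel hk hs c c')

/-- The linear comparison map between two algebras of the family. -/
def compare (c c' : F) : DA F k s c' →ₗ[F] DA F k s c :=
  LinearMap.applyₗ (1 : DA F k s c) ∘ₗ (twist hk hs c c').toLinearMap

theorem compare_apply (c c' : F) (x : DA F k s c') :
    compare hk hs c c' x = twist hk hs c c' x 1 := rfl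

theorem coeffAl_one : coeffAl c hk hs (1 : DA F k s c) = 0 := by
  simpa using coeffAl_algebraMap (c := c) hk hs 1

theorem compare_gen (c c' : F) (t : Gen) :
    compare hk hs c c' (mk F k s c' (gen F t)) = mk F k s c (gen F t) := by
  rw [compare_apply, twist, liftDA_mk, gen, FreeAlgebra.lift_ι_apply, twistGen_apply,
    coeffAl_one]
  simp [gen]

theorem compare_algebraMap (c c' : F) (r : F) :
    compare hk hs c c' (algebraMap F _ r) = algebraMap F _ r := by
  rw [compare_apply, AlgHom.commutes, Module.algebraMap_end_apply, Algebra.algebraMap_eq_smul_one]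

theorem twist_apply (c c' : F) (x : DA F k s c') (y : DA F k s c) :
    twist hk hs c c' x y = compare hk hs c c' x * y +
      ((c' - c) * coeffAl c hk hs (compare hk hs c c' x) * coeffAl c hk hs y) • Soc F k s c := by
  induction x using DA_induction generalizing y with
  | scalar r =>
    rw [compare_algebraMap, coeffAl_algebraMap, AlgHom.commutes, Module.algebraMap_end_apply,
      ← Algebra.smul_def]
    simp
  | generator t =>
    rw [compare_gen, ← twistGen_apply, twist, liftDA_mk, gen, FreeAlgebra.lift_ι_apply]
  | mul x x' hx hx' =>
    have h : compare hk hs c c' (x * x') = compare hk hs c c' x * compare hk hs c c' x' +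
        ((c' - c) * coeffAl c hk hs (compare hk hs c c' x) *
          coeffAl c hk hs (compare hk hs c c' x')) • Soc F k s c := by
      rw [compare_apply hk hs c c' (x * x'), map_mul, Module.End.mul_apply, ← compare_apply, hx]
    rw [h, map_mul, Module.End.mul_apply, hx', hx]
    simp only [mul_add, add_mul, mul_smul_comm, smul_mul_assoc, mul_Soc hk hs, Soc_mul hk hs,
      map_add, map_smul, coeffAl_mul, coeffAl_Soc, smul_smul, mul_assoc, smul_eq_mul,
      mul_zero, add_zero, add_smul, add_assoc]
    congr 1
    simp only [← add_smul]
    congr 1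
    ring
  | add x x' hx hx' =>
    rw [map_add, LinearMap.add_apply, hx, hx', map_add, map_add, mul_add, add_mul, add_mul,
      add_smul]
    abel

theorem compare_mul (c c' : F) (x y : DA F k s c') :
    compare hk hs c c' (x * y) = compare hk hs c c' x * compare hk hs c c' y +
      ((c' - c) * coeffAl c hk hs (compare hk hs c c' x) *
        coeffAl c hk hs (compare hk hs c c' y)) • Soc F k s c := by
  rw [compare_apply hk hs c c' (x * y), map_mul, Module.End.mul_apply, ← compare_apply,
    twist_apply]

theorem dual_compare (c c' : F) (x : DA F k s c') :
    coeffE1 c hk hs (compare hk hs c c' x) = coeffE1 c' hk hs x ∧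
      coeffAl c hk hs (compare hk hs c c' x) = coeffAl c' hk hs x := by
  induction x using DA_induction with
  | scalar r => simp [compare_algebraMap, coeffE1_algebraMap, coeffAl_algebraMap]
  | generator t => simp [compare_gen, coeffE1_gen, coeffAl_gen]
  | mul x y hx hy =>
    simp [compare_mul, coeffE1_mul, coeffAl_mul, coeffE1_Soc, coeffAl_Soc, hx, hy]
  | add x y hx hy => simp [hx, hy]

theorem compare_Soc (c c' : F) : compare hk hs c c' (Soc F k s c') = Soc F k s c := by
  have hB : ∀ x : DA F k s c', compare hk hs c c' (x * Be F k s c') =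
      compare hk hs c c' x * Be F k s c := by
    intro x
    rw [compare_mul, Be, compare_gen, ← Be, coeffAl_Be]
    simp
  have hG : ∀ x : DA F k s c', compare hk hs c c' (x * Ga F k s c') =
      compare hk hs c c' x * Ga F k s c := by
    intro x
    rw [compare_mul, Ga, compare_gen, ← Ga, coeffAl_Ga]
    simp
  have hA : compare hk hs c c' (Al F k s c') = Al F k s c := compare_gen hk hs c c' .a
  have hABG : compare hk hs c c' (ABG F k s c') = ABG F k s c := by
    rw [ABG, hG, hB, hA, ABG]
  have hABG0 : coeffAl c hk hs (ABG F k s c) = 0 := by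
    simp [ABG, coeffAl_mul, coeffE1_mul, coeffAl_Ga, coeffE1_Ga]
  have hpow : ∀ n : ℕ, compare hk hs c c' (ABG F k s c' ^ n) = ABG F k s c ^ n := by
    intro n
    induction n with
    | zero => simpa using compare_algebraMap hk hs c c' 1
    | succ n ih => rw [pow_succ, pow_succ, compare_mul, ih, hABG, hABG0]; simp
  exact hpow k

theorem compare_compare (c c' : F) (x : DA F k s c') :
    compare hk hs c' c (compare hk hs c c' x) = x := by
  induction x using DA_induction with
  | scalar r => simp [compare_algebraMap]
  | generator t => simp [compare_gen]
  | mul x y hx hy =>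
    rw [compare_mul, map_add, map_smul, compare_mul, hx, hy, compare_Soc,
      (dual_compare hk hs c c' x).2, (dual_compare hk hs c c' y).2, add_assoc, ← add_smul]
    convert add_zero (x * y)
    convert zero_smul F _
    ring
  | add x y hx hy => simp [hx, hy]

theorem compare_mem_Kspan (c c' : F) {x : DA F k s c'} (hx : x ∈ Kspan F (DA F k s c')) :
    compare hk hs c c' x ∈ Kspan F (DA F k s c) := by
  induction hx using Submodule.span_induction with
  | mem x h =>
    obtain ⟨u, v, rfl⟩ := h
    refine Submodule.subset_span ⟨compare hk hs c c' u, compare hk hs c c' v, ?_⟩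
    rw [map_sub, compare_mul, compare_mul, mul_right_comm (c' - c)]
    abel
  | zero => simp
  | add x y _ _ hx hy => rw [map_add]; exact add_mem hx hy
  | smul r x _ hx => rw [map_smul]; exact Submodule.smul_mem _ _ hx

theorem compare_mem_Kspan_iff (c c' : F) {x : DA F k s c'} :
    compare hk hs c c' x ∈ Kspan F (DA F k s c) ↔ x ∈ Kspan F (DA F k s c') := by
  refine ⟨fun h => ?_, compare_mem_Kspan hk hs c c'⟩
  simpa [compare_compare] using compare_mem_Kspan hk hs c' c h

end Dual

section Trace

open Polynomial

variable {F} {k s} {c}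

/-- The matrices by which the generators act on a cyclic string module. -/
def matGen (F : Type) [Field F] : Gen → Matrix (Fin 3) (Fin 3) F[X]
  | .e1 => Matrix.single 0 0 1 + Matrix.single 1 1 1
  | .e2 => Matrix.single 2 2 1
  | .a => Matrix.single 0 1 X
  | .b => Matrix.single 1 2 1
  | .g => Matrix.single 2 0 1
  | .h => 0

/-- The action of the generators on the uniserial module at vertex `2` built from `η`. -/
def polyGen (F : Type) [Field F] : Gen → F[X]
  | .e2 => 1
  | .h => X
  | _ => 0

/-- The matrix representation of the free algebra given by `matGen`. -/
def matHom (F : Type) [Field F] : FreeAlgebra F Gen →ₐ[F] Matrix (Fin 3) (Fin 3) F[X] :=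
  FreeAlgebra.lift F (matGen F)

/-- The representation of the free algebra given by `polyGen`. -/
def polyHom (F : Type) [Field F] : FreeAlgebra F Gen →ₐ[F] F[X] :=
  FreeAlgebra.lift F (polyGen F)

theorem matHom_gen (t : Gen) : matHom F (gen F t) = matGen F t := by
  simp [matHom, gen]

theorem polyHom_gen (t : Gen) : polyHom F (gen F t) = polyGen F t := by
  simp [polyHom, gen]

/-- The symmetric linear form counting the cyclic words equal to the socle element. -/
def tau (F : Type) [Field F] (k s : ℕ) : FreeAlgebra F Gen →ₗ[F] F :=
  lcoeff F k ∘ₗ (Matrix.traceLinearMap (Fin 3) F F[X]) ∘ₗ (matHom F).toLinearMap +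
    lcoeff F s ∘ₗ (polyHom F).toLinearMap

theorem tau_apply (x : FreeAlgebra F Gen) :
    tau F k s x = (matHom F x).trace.coeff k + (polyHom F x).coeff s := rfl

theorem tau_mul_comm (x y : FreeAlgebra F Gen) : tau F k s (x * y) = tau F k s (y * x) := by
  simp only [tau_apply, map_mul, Matrix.trace_mul_comm (matHom F x), mul_comm (polyHom F x)]

theorem coeff_sq_of_odd [CharP F 2] (p : F[X]) {n : ℕ} (hn : Odd n) : (p * p).coeff n = 0 := by
  rw [← pow_two, ← map_frobenius_expand 2 p, coeff_map, coeff_expand two_pos,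
    if_neg hn.not_two_dvd_nat, map_zero]

theorem tau_sq [CharP F 2] (hk : Odd k) (hs : Odd s) (x : FreeAlgebra F Gen) :
    tau F k s (x * x) = 0 := by
  set M := matHom F x with hM
  have h : (M * M).trace = M 0 0 * M 0 0 + M 1 1 * M 1 1 + M 2 2 * M 2 2 := by
    simp only [Matrix.trace, Matrix.diag, Matrix.mul_apply, Fin.sum_univ_three]
    linear_combination
      (M 0 1 * M 1 0 + M 0 2 * M 2 0 + M 1 2 * M 2 1) * CharTwo.two_eq_zero (R := F[X])
  rw [tau_apply, map_mul, map_mul, ← hM, h]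
  simp only [coeff_add, coeff_sq_of_odd _ hk, coeff_sq_of_odd _ hs, add_zero]

/-- At `X = 0` the representing matrices are triangular for a suitable order of the index set, with
equal diagonal entries at `0` and `1`, and with the constant term of `polyHom` at `2`. -/
theorem matHom_coeff_zero (x : FreeAlgebra F Gen) :
    (matHom F x 0 1).coeff 0 = 0 ∧ (matHom F x 0 2).coeff 0 = 0 ∧ (matHom F x 2 1).coeff 0 = 0 ∧
      (matHom F x 0 0).coeff 0 = (matHom F x 1 1).coeff 0 ∧
      (matHom F x 2 2).coeff 0 = (polyHom F x).coeff 0 := by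
  induction x using FreeAlgebra.induction with
  | grade0 r => simp [Matrix.algebraMap_matrix_apply]
  | grade1 t =>
    change (matHom F (gen F t) 0 1).coeff 0 = 0 ∧ (matHom F (gen F t) 0 2).coeff 0 = 0 ∧
      (matHom F (gen F t) 2 1).coeff 0 = 0 ∧
      (matHom F (gen F t) 0 0).coeff 0 = (matHom F (gen F t) 1 1).coeff 0 ∧
      (matHom F (gen F t) 2 2).coeff 0 = (polyHom F (gen F t)).coeff 0
    rw [matHom_gen, polyHom_gen]
    cases t <;> simp [matGen, polyGen]
  | mul x y hx hy =>
    obtain ⟨h1, h2, h3, h4, h5⟩ := hx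
    obtain ⟨g1, g2, g3, g4, g5⟩ := hy
    simp [Matrix.mul_apply, Fin.sum_univ_three, mul_coeff_zero, h1, h2, h3, h4, h5, g1, g2, g3,
      g4, g5]
  | add x y hx hy => simp [hx, hy]

theorem single_pow (i : Fin 3) (p : F[X]) (n : ℕ) (hn : n ≠ 0) :
    Matrix.single i i p ^ n = Matrix.single i i (p ^ n) := by
  induction n with
  | zero => exact absurd rfl hn
  | succ n ih =>
    rcases eq_or_ne n 0 with rfl | h
    · simp
    · rw [pow_succ, ih h, Matrix.single_mul_single_same, pow_succ]

theorem tau_mul_rel (hk : 1 ≤ k) (hs : 1 ≤ s) ⦃x y : FreeAlgebra F Gen⦄ (h : Rel F k s 0 x y)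
    (u : FreeAlgebra F Gen) : tau F k s (u * x) = tau F k s (u * y) := by
  have hk' : k ≠ 0 := by omega
  have hs' : s ≠ 0 := by omega
  have hu := matHom_coeff_zero u
  have hcoeff : ∀ (p : F[X]) (n : ℕ), (p * X ^ n).coeff n = p.coeff 0 := fun p n => by
    simpa using coeff_mul_X_pow p n 0
  cases h
  case abg =>
    simp [tau_apply, matHom_gen, polyHom_gen, matGen, polyGen, single_pow _ _ _ hk', hk',
      Matrix.trace_mul_single, hcoeff, hu]
  case hs =>
    simp [tau_apply, matHom_gen, polyHom_gen, matGen, polyGen, single_pow _ _ _ hk', hk', hs',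
      Matrix.trace_mul_single, hcoeff, hu]
  case unit =>
    have h1 : (Matrix.single 0 0 1 + Matrix.single 1 1 1 + Matrix.single 2 2 1 :
        Matrix (Fin 3) (Fin 3) F[X]) = 1 := by
      ext i j : 2
      fin_cases i <;> fin_cases j <;> simp
    simp only [tau_apply, map_mul, map_add, matHom_gen, polyHom_gen, matGen, polyGen, h1, mul_one,
      zero_add]
  all_goals
    simp [tau_apply, matHom_gen, polyHom_gen, matGen, polyGen, mul_add, add_mul]

/-- The radical of the form `(x, y) ↦ τ(xy)`, as a ring congruence. -/
def tauCon (F : Type) [Field F] (k s : ℕ) : RingCon (FreeAlgebra F Gen) where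
  r x y := ∀ u, tau F k s (u * x) = tau F k s (u * y)
  iseqv := ⟨fun _ _ => rfl, fun h u => (h u).symm, fun h h' u => (h u).trans (h' u)⟩
  add' h h' u := by rw [mul_add, mul_add, map_add, map_add, h, h']
  mul' {w x y z} h h' u := by
    rw [← mul_assoc, h', tau_mul_comm, ← mul_assoc, h, mul_assoc, tau_mul_comm, mul_assoc]

theorem tauCon_mk_rel (hk : 1 ≤ k) (hs : 1 ≤ s) ⦃x y : FreeAlgebra F Gen⦄ (h : Rel F k s 0 x y) :
    (tauCon F k s).mkₐ (α := F) x = (tauCon F k s).mkₐ (α := F) y :=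
  (RingCon.eq _).2 (tau_mul_rel hk hs h)

/-- The quotient map from `DA F k s 0` to the quotient of the free algebra by the radical of the
form defined by `τ`. -/
def toTauQuotient (hk : 1 ≤ k) (hs : 1 ≤ s) : DA F k s 0 →ₐ[F] (tauCon F k s).Quotient :=
  liftDA ((tauCon F k s).mkₐ (α := F)) (tauCon_mk_rel hk hs)

theorem tau_eq_of_mk_eq (hk : 1 ≤ k) (hs : 1 ≤ s) {x y : FreeAlgebra F Gen}
    (h : mk F k s 0 x = mk F k s 0 y) : tau F k s x = tau F k s y := by
  have h' : (tauCon F k s).mkₐ (α := F) x = (tauCon F k s).mkₐ (α := F) y :=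
    (liftDA_mk _ (tauCon_mk_rel hk hs) x).symm.trans
      ((congrArg (toTauQuotient hk hs) h).trans (liftDA_mk _ (tauCon_mk_rel hk hs) y))
  simpa using (RingCon.eq _).1 h' 1

/-- Elements of the commutator space lift to elements killed by `τ`. -/
theorem exists_lift_of_mem_Kspan {x : DA F k s 0} (hx : x ∈ Kspan F (DA F k s 0)) :
    ∃ y, mk F k s 0 y = x ∧ tau F k s y = 0 := by
  induction hx using Submodule.span_induction with
  | mem x h =>
    obtain ⟨u, v, rfl⟩ := h
    obtain ⟨u, rfl⟩ := mk_surjective u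
    obtain ⟨v, rfl⟩ := mk_surjective v
    exact ⟨u * v - v * u, by simp, by rw [map_sub, tau_mul_comm, sub_self]⟩
  | zero => exact ⟨0, map_zero _, map_zero _⟩
  | add x y _ _ hx hy =>
    obtain ⟨x, rfl, hx⟩ := hx
    obtain ⟨y, rfl, hy⟩ := hy
    exact ⟨x + y, map_add _ _ _, by rw [map_add, hx, hy, add_zero]⟩
  | smul r x _ hx =>
    obtain ⟨x, rfl, hx⟩ := hx
    exact ⟨r • x, map_smul _ _ _, by rw [map_smul, hx, smul_zero]⟩

theorem eq_zero_of_sq_add_smul_Soc_mem [CharP F 2] (hk : Odd k) (hs : Odd s) {x : DA F k s 0}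
    {r : F} (h : x * x + r • Soc F k s 0 ∈ Kspan F (DA F k s 0)) : r = 0 := by
  have hk0 : k ≠ 0 := hk.pos.ne'
  obtain ⟨y, hy, hy0⟩ := exists_lift_of_mem_Kspan h
  obtain ⟨x, rfl⟩ := mk_surjective x
  set z : FreeAlgebra F Gen := (gen F .a * gen F .b * gen F .g) ^ k with hz
  have hzS : mk F k s 0 z = Soc F k s 0 := by simp [hz, Soc, ABG, Al, Be, Ga]
  have hτ : tau F k s z = 1 := by
    simp [hz, tau_apply, matHom_gen, polyHom_gen, matGen, polyGen, single_pow _ _ _ hk0, hk0]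
  have h2 : tau F k s (x * x + r • z) = 0 := by
    rw [← hy0]
    refine tau_eq_of_mk_eq hk.pos hs.pos ?_
    rw [hy, map_add, map_mul, map_smul, hzS]
  simpa [tau_sq hk hs, hτ] using h2

end Trace

section Finite

variable {F} {k s}

/-- The images of the paths of length `n` along the cyclic string `αβγαβγ⋯` that start with `α`,
`β` and `γ` respectively. -/
def path (F : Type) [Field F] (k s : ℕ) : ℕ → DA F k s 0 × DA F k s 0 × DA F k s 0
  | 0 => (E1 F k s 0, E1 F k s 0, E2 F k s 0)
  | n + 1 => (Al F k s 0 * (path F k s n).2.1, Be F k s 0 * (path F k s n).2.2,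
      Ga F k s 0 * (path F k s n).1)

theorem path_add (i n : ℕ) : path F k s (n + 3 * i) =
    (ABG F k s 0 ^ i * (path F k s n).1, BGA F k s 0 ^ i * (path F k s n).2.1,
      GAB F k s 0 ^ i * (path F k s n).2.2) := by
  induction i with
  | zero => simp
  | succ i ih =>
    have h : path F k s (n + 3 * (i + 1)) =
        (ABG F k s 0 * (path F k s (n + 3 * i)).1, BGA F k s 0 * (path F k s (n + 3 * i)).2.1,
          GAB F k s 0 * (path F k s (n + 3 * i)).2.2) := by
      change path F k s (n + 3 * i + 1 + 1 + 1) = _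
      simp only [path, ABG, BGA, GAB, mul_assoc]
    rw [h, ih]
    simp only [pow_succ', mul_assoc]

theorem path_eq_zero (hk : 1 ≤ k) {n : ℕ} (hn : 3 * k < n) : path F k s n = 0 := by
  obtain ⟨m, rfl⟩ : ∃ m, n = m + 1 + 3 * k := ⟨n - 3 * k - 1, by omega⟩
  rw [path_add]
  simp only [path, BGA_pow, ← mul_assoc, ← Ga_mul_ABG_pow]
  change (Soc F k s 0 * Al F k s 0 * _, Soc F k s 0 * Be F k s 0 * _, Ga F k s 0 * Soc F k s 0 * _)
    = _
  simp [Soc_mul_Al hk, Soc_mul_Be hk, Ga_mul_Soc hk]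

theorem Et_pow_succ_eq_zero (hk : 1 ≤ k) : Et F k s 0 ^ (s + 1) = 0 := by
  obtain ⟨j, hj⟩ := Nat.exists_eq_add_of_le' hk
  have h : GAB F k s 0 ^ k = Ga F k s 0 * (Al F k s 0 * Be F k s 0 * GAB F k s 0 ^ j) := by
    rw [hj, pow_succ', GAB]
    simp only [mul_assoc]
  rw [pow_succ', Et_pow, h, ← mul_assoc, Et_mul_Ga, zero_mul]

theorem path_start (n : ℕ) :
    E1 F k s 0 * (path F k s n).1 = (path F k s n).1 ∧
      E1 F k s 0 * (path F k s n).2.1 = (path F k s n).2.1 ∧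
      E2 F k s 0 * (path F k s n).2.2 = (path F k s n).2.2 := by
  cases n <;> simp [path, ← mul_assoc, E1_mul_E1, E2_mul_E2, E1_mul_Al, E1_mul_Be, E2_mul_Ga]

theorem mul_eq_zero_of_start {A : Type} [Ring A] {x e f y : A} (hx : x * f = x) (hef : f * e = 0)
    (hy : e * y = y) : x * y = 0 := by
  rw [← hx, ← hy, mul_assoc, ← mul_assoc f, hef, zero_mul, mul_zero]

/-- A finite spanning set of `DA F k s 0`. -/
def spanningSet (F : Type) [Field F] (k s : ℕ) : Set (DA F k s 0) :=
  (fun j => Et F k s 0 ^ j) '' Set.Iic s ∪ (fun n => (path F k s n).1) '' Set.Iic (3 * k) ∪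
    (fun n => (path F k s n).2.1) '' Set.Iic (3 * k) ∪
    (fun n => (path F k s n).2.2) '' Set.Iic (3 * k)

theorem spanningSet_finite : (spanningSet F k s).Finite := by
  refine ((Set.Finite.union ?_ ?_).union ?_).union ?_ <;> exact (Set.finite_Iic _).image _

theorem path_mem_span (hk : 1 ≤ k) (n : ℕ) :
    (path F k s n).1 ∈ Submodule.span F (spanningSet F k s) ∧
      (path F k s n).2.1 ∈ Submodule.span F (spanningSet F k s) ∧
      (path F k s n).2.2 ∈ Submodule.span F (spanningSet F k s) := by
  rcases le_or_gt n (3 * k) with h | h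
  · exact ⟨Submodule.subset_span (.inl (.inl (.inr ⟨n, h, rfl⟩))),
      Submodule.subset_span (.inl (.inr ⟨n, h, rfl⟩)), Submodule.subset_span (.inr ⟨n, h, rfl⟩)⟩
  · simp [path_eq_zero hk h]

theorem Et_pow_mem_span (hk : 1 ≤ k) (n : ℕ) :
    Et F k s 0 ^ n ∈ Submodule.span F (spanningSet F k s) := by
  rcases le_or_gt n s with h | h
  · exact Submodule.subset_span (.inl (.inl (.inl ⟨n, h, rfl⟩)))
  · rw [pow_eq_zero_of_le (Nat.succ_le_of_lt h) (Et_pow_succ_eq_zero hk)]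
    exact zero_mem _

theorem generator_mul_mem_span (hk : 1 ≤ k) (t : Gen) {v : DA F k s 0}
    (hv : v ∈ spanningSet F k s) :
    mk F k s 0 (gen F t) * v ∈ Submodule.span F (spanningSet F k s) := by
  have hpath := path_mem_span (F := F) (s := s) hk
  have hEt := Et_pow_mem_span (F := F) (s := s) hk
  have hAl : Al F k s 0 * Al F k s 0 = 0 := by rw [Al_mul_Al, zero_smul]
  have key : ∀ x, mk F k s 0 (gen F t) * v = 0 ∨ mk F k s 0 (gen F t) * v = x →
      x ∈ Submodule.span F (spanningSet F k s) →
      mk F k s 0 (gen F t) * v ∈ Submodule.span F (spanningSet F k s) := by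
    rintro x (h | h) hx <;> rw [h]
    exacts [zero_mem _, hx]
  rcases hv with ((⟨n, -, rfl⟩ | ⟨n, -, rfl⟩) | ⟨n, -, rfl⟩) | ⟨n, -, rfl⟩
  · rcases n with _ | n
    · simp only [pow_zero, mul_one]
      cases t
      · exact (hpath 0).1
      · exact (hpath 0).2.2
      · change Al F k s 0 ∈ _
        simpa [path, Al_mul_E1] using (hpath 1).1
      · change Be F k s 0 ∈ _
        simpa [path, Be_mul_E2] using (hpath 1).2.1
      · change Ga F k s 0 ∈ _
        simpa [path, Ga_mul_E1] using (hpath 1).2.2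
      · change Et F k s 0 ∈ _
        simpa using hEt 1
    · have h2 : E2 F k s 0 * Et F k s 0 ^ (n + 1) = Et F k s 0 ^ (n + 1) := by
        rw [pow_succ', ← mul_assoc, E2_mul_Et]
      cases t
      · exact key 0 (.inl (mul_eq_zero_of_start E1_mul_E1 E1_mul_E2 h2)) (zero_mem _)
      · exact key _ (.inr h2) (hEt _)
      · exact key 0 (.inl (mul_eq_zero_of_start Al_mul_E1 E1_mul_E2 h2)) (zero_mem _)
      · refine key 0 (.inl ?_) (zero_mem _)
        change Be F k s 0 * Et F k s 0 ^ (n + 1) = 0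
        rw [pow_succ', ← mul_assoc, Be_mul_Et, zero_mul]
      · exact key 0 (.inl (mul_eq_zero_of_start Ga_mul_E1 E1_mul_E2 h2)) (zero_mem _)
      · exact key _ (.inr (pow_succ' _ _).symm) (hEt _)
  · have h1 := (path_start (F := F) (k := k) (s := s) n).1
    cases t
    · exact key _ (.inr h1) (hpath n).1
    · exact key 0 (.inl (mul_eq_zero_of_start E2_mul_E2 E2_mul_E1 h1)) (zero_mem _)
    · change Al F k s 0 * (path F k s n).1 ∈ _
      rcases n with _ | n
      · simpa [path] using (hpath 1).1
      · simp [path, ← mul_assoc, hAl]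
    · exact key 0 (.inl (mul_eq_zero_of_start Be_mul_E2 E2_mul_E1 h1)) (zero_mem _)
    · exact (hpath (n + 1)).2.2
    · exact key 0 (.inl (mul_eq_zero_of_start Et_mul_E2 E2_mul_E1 h1)) (zero_mem _)
  · have h1 := (path_start (F := F) (k := k) (s := s) n).2.1
    cases t
    · exact key _ (.inr h1) (hpath n).2.1
    · exact key 0 (.inl (mul_eq_zero_of_start E2_mul_E2 E2_mul_E1 h1)) (zero_mem _)
    · exact (hpath (n + 1)).1
    · exact key 0 (.inl (mul_eq_zero_of_start Be_mul_E2 E2_mul_E1 h1)) (zero_mem _)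
    · change Ga F k s 0 * (path F k s n).2.1 ∈ _
      rcases n with _ | n
      · simpa [path] using (hpath 1).2.2
      · simp [path, ← mul_assoc, Ga_mul_Be]
    · exact key 0 (.inl (mul_eq_zero_of_start Et_mul_E2 E2_mul_E1 h1)) (zero_mem _)
  · have h2 := (path_start (F := F) (k := k) (s := s) n).2.2
    cases t
    · exact key 0 (.inl (mul_eq_zero_of_start E1_mul_E1 E1_mul_E2 h2)) (zero_mem _)
    · exact key _ (.inr h2) (hpath n).2.2
    · exact key 0 (.inl (mul_eq_zero_of_start Al_mul_E1 E1_mul_E2 h2)) (zero_mem _)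
    · exact (hpath (n + 1)).2.1
    · exact key 0 (.inl (mul_eq_zero_of_start Ga_mul_E1 E1_mul_E2 h2)) (zero_mem _)
    · change Et F k s 0 * (path F k s n).2.2 ∈ _
      rcases n with _ | n
      · simpa [path, Et_mul_E2] using hEt 1
      · simp [path, ← mul_assoc, Et_mul_Ga]

theorem finiteDimensional_DA (hk : 1 ≤ k) : FiniteDimensional F (DA F k s 0) := by
  have htop : Submodule.span F (spanningSet F k s) = ⊤ := by
    refine eq_top_iff.2 fun x _ => mem_of_generator_mul_mem ?_ (fun t v hv => ?_) x
    · simpa using Et_pow_mem_span (F := F) (s := s) hk 0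
    · have hle : Submodule.span F (spanningSet F k s) ≤
          (Submodule.span F (spanningSet F k s)).comap
            (LinearMap.mulLeft F (mk F k s 0 (gen F t))) :=
        Submodule.span_le.2 fun v hv => generator_mul_mem_span hk t hv
      exact hle hv
  have := FiniteDimensional.span_of_finite F (spanningSet_finite (F := F) (k := k) (s := s))
  rw [htop] at this
  exact Module.Finite.of_surjective (⊤ : Submodule F (DA F k s 0)).subtype
    fun x => ⟨⟨x, trivial⟩, rfl⟩

end Finite

section Dimension

variable {F} {k s}

/-- In characteristic `2`, the set `T₁(A)` is a subspace. -/
def T1 [CharP F 2] (c : F) : Submodule F (DA F k s c) where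
  carrier := T1set F k s c
  zero_mem' := by simp [T1set]
  add_mem' {x y} hx hy := by
    have h2 : (2 : DA F k s c) = 0 := by
      rw [← map_ofNat (algebraMap F (DA F k s c)) 2, CharTwo.two_eq_zero, map_zero]
    have h : (x + y) ^ 2 = x ^ 2 + y ^ 2 + (x * y - y * x) := by
      have : (x + y) ^ 2 = x ^ 2 + y ^ 2 + (x * y - y * x) + 2 * (y * x) := by noncomm_ring
      rw [this, h2, zero_mul, add_zero]
    change (x + y) ^ 2 ∈ Kspan F (DA F k s c)
    rw [h]
    exact add_mem (add_mem hx hy) (Submodule.subset_span ⟨x, y, rfl⟩)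
  smul_mem' r x hx := by
    change (r • x) ^ 2 ∈ Kspan F (DA F k s c)
    rw [smul_pow]
    exact Submodule.smul_mem _ _ hx

theorem span_T1set [CharP F 2] (c : F) : Submodule.span F (T1set F k s c) = T1 c :=
  Submodule.span_eq (T1 c)

theorem mem_T1 [CharP F 2] {c : F} {x : DA F k s c} :
    x ∈ T1 c ↔ x * x ∈ Kspan F (DA F k s c) := by
  rw [← pow_two]; rfl

theorem map_compare_T1 [CharP F 2] (hk : Odd k) (hs : Odd s) :
    (T1 (1 : F)).map (compare (k := k) (s := s) hk.pos hs.pos 0 1) =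
      T1 0 ⊓ LinearMap.ker (coeffAl 0 hk.pos hs.pos) := by
  have key : ∀ x : DA F k s 1, x ∈ T1 (1 : F) ↔
      compare hk.pos hs.pos 0 1 x ∈ T1 0 ⊓ LinearMap.ker (coeffAl 0 hk.pos hs.pos) := by
    intro x
    rw [Submodule.mem_inf, mem_T1, mem_T1, LinearMap.mem_ker,
      ← compare_mem_Kspan_iff hk.pos hs.pos 0 1, compare_mul]
    constructor
    · intro h
      have h0 : coeffAl 0 hk.pos hs.pos (compare hk.pos hs.pos 0 1 x) = 0 := by
        simpa using eq_zero_of_sq_add_smul_Soc_mem hk hs h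
      exact ⟨by simpa [h0] using h, h0⟩
    · rintro ⟨h, h0⟩
      simpa [h0] using h
  ext y
  constructor
  · rintro ⟨x, hx, rfl⟩
    exact (key x).1 hx
  · intro hy
    have hxy := compare_compare hk.pos hs.pos (1 : F) 0 y
    exact ⟨compare hk.pos hs.pos 1 0 y, (key _).2 (by rwa [hxy]), hxy⟩

theorem Al_mem_T1 [CharP F 2] : Al F k s 0 ∈ T1 (0 : F) := by
  rw [mem_T1, Al_mul_Al, zero_smul]
  exact zero_mem _

theorem finrank_T1 [CharP F 2] (hk : Odd k) (hs : Odd s) :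
    Module.finrank F (T1 (k := k) (s := s) (0 : F)) =
      Module.finrank F (T1 (k := k) (s := s) (1 : F)) + 1 := by
  have := finiteDimensional_DA (F := F) (s := s) hk.pos
  have hinj : Function.Injective (compare (F := F) hk.pos hs.pos 0 1) :=
    Function.LeftInverse.injective (compare_compare hk.pos hs.pos (0 : F) 1)
  set f := (coeffAl (0 : F) hk.pos hs.pos).domRestrict (T1 0) with hf
  have hrange : LinearMap.range f = ⊤ := by
    refine LinearMap.range_eq_top.2 fun r => ⟨r • ⟨Al F k s 0, Al_mem_T1⟩, ?_⟩
    simp [hf, coeffAl_Al]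
  have hker : Module.finrank F (LinearMap.ker f) =
      Module.finrank F (T1 (k := k) (s := s) (1 : F)) := by
    have hmap : (LinearMap.ker f).map (T1 0).subtype =
        T1 0 ⊓ LinearMap.ker (coeffAl 0 hk.pos hs.pos) := by
      ext x
      simp [hf, and_comm]
    rw [(Submodule.equivMapOfInjective _ hinj (T1 1)).finrank_eq, map_compare_T1 hk hs, ← hmap,
      (Submodule.equivMapOfInjective _ (T1 (0 : F)).injective_subtype
        (LinearMap.ker f)).finrank_eq]
  rw [← f.finrank_range_add_finrank_ker, hrange, hker, finrank_top, Module.finrank_self, add_comm]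

end Dimension

/-- **Case `k`, `s` odd (dihedral type).**  For `k, s ≥ 1` both odd,
`dim_F T₁(A^{k,s}_0) = dim_F T₁(A^{k,s}_1) + 1`; in particular the two spaces have
different F-dimensions. -/
theorem dihedral_T1_dimensions_differ_odd_odd
    (F : Type) [Field F] [IsAlgClosed F] [CharP F 2]
    (k s : ℕ) (hk : 1 ≤ k) (hs : 1 ≤ s) (hkodd : Odd k) (hsodd : Odd s) :
    Module.finrank F ↥(Submodule.span F (T1set F k s 0))
      = Module.finrank F ↥(Submodule.span F (T1set F k s 1)) + 1 ∧
    Module.finrank F ↥(Submodule.span F (T1set F k s 0))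
      ≠ Module.finrank F ↥(Submodule.span F (T1set F k s 1)) := by
  rw [span_T1set, span_T1set, finrank_T1 hkodd hsodd]
  exact ⟨rfl, Nat.succ_ne_self _⟩

end DihedralPaper

end
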